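/- arXiv:2211.06884 — 4 statements merged into one kernel-verified Lean document; each statement's English description precedes it below -/
import Mathlib

section
/- Let α be real with 0 < α ≤ 1, let d ≥ 1 be real, and let W_j, W_i, n_j, n_i be reals with 0 < W_j ≤ W_i, 0 < n_j ≤ n_i, and n_i ≤ W_i. Then ⌈(d+1)^α · n_i / W_i⌉ − ⌈d^α · n_j / W_j⌉ < 2 + (d^α / W_i)·(n_i − n_j). -/
theorem stmt5 (α d Wj Wi nj ni : ℝ)
    (hα0 : 0 < α) (hα1 : α ≤ 1) (hd : 1 ≤ d)
    (hWj : 0 < Wj) (hWji : Wj ≤ Wi)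
    (hnj : 0 < nj) (hnji : nj ≤ ni) (hni : ni ≤ Wi) :
    ((⌈(d + 1) ^ α * ni / Wi⌉ : ℝ) - (⌈d ^ α * nj / Wj⌉ : ℝ))
      < 2 + d ^ α / Wi * (ni - nj) := by
  have hd0 : 0 ≤ d := zero_le_one.trans hd
  have hWi : 0 < Wi := hWj.trans_le hWji
  have hni0 : 0 < ni := hnj.trans_le hnji
  have hsub : (d + 1) ^ α ≤ d ^ α + 1 := by
    have h := NNReal.rpow_add_le_add_rpow ⟨d, hd0⟩ 1 hα0.le hα1
    rw [NNReal.one_rpow] at h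
    exact_mod_cast h
  have hupper : (d + 1) ^ α * ni / Wi ≤ d ^ α * ni / Wi + 1 := by
    calc (d + 1) ^ α * ni / Wi ≤ (d ^ α + 1) * ni / Wi := by gcongr
      _ = d ^ α * ni / Wi + ni / Wi := by ring
      _ ≤ d ^ α * ni / Wi + 1 := by gcongr; exact (div_le_one hWi).2 hni
  have hlower : d ^ α * nj / Wi ≤ d ^ α * nj / Wj := by gcongr
  have hsplit : d ^ α / Wi * (ni - nj) = d ^ α * ni / Wi - d ^ α * nj / Wi := by ring
  linarith [Int.ceil_lt_add_one ((d + 1) ^ α * ni / Wi), Int.le_ceil (d ^ α * nj / Wj)]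
end

section
/- Let α ≥ 1 be real, let Δ ≥ 1 be real, let k be a natural number, and let d_0, …, d_{k−1} be reals with 1 ≤ d_i ≤ Δ + i for each 0 ≤ i < k. Then ∑_{i=0}^{k−1} (1 + (d_i + 1)^α − d_i^α) ≤ k + (Δ + k)^α − Δ^α. -/
/-- The increments of a convex function over steps of a fixed length are monotone. -/
theorem ConvexOn.sub_le_sub_of_le {s : Set ℝ} {f : ℝ → ℝ} (hf : ConvexOn ℝ s f) {x y h : ℝ}
    (hx : x ∈ s) (hy : y + h ∈ s) (hxy : x ≤ y) (hh : 0 < h) :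
    f (x + h) - f x ≤ f (y + h) - f y := by
  have hpos : 0 < y + h - x := by linarith
  have ha : 0 ≤ (y - x) / (y + h - x) := div_nonneg (by linarith) hpos.le
  have hb : 0 ≤ h / (y + h - x) := div_nonneg hh.le hpos.le
  have hab : (y - x) / (y + h - x) + h / (y + h - x) = 1 := by
    field_simp
    ring
  have h₁ := hf.2 hx hy ha hb hab
  have h₂ := hf.2 hx hy hb ha (by rw [add_comm, hab])
  simp only [smul_eq_mul] at h₁ h₂
  have e₁ : (y - x) / (y + h - x) * x + h / (y + h - x) * (y + h) = x + h := by
    field_simp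
    ring
  have e₂ : h / (y + h - x) * x + (y - x) / (y + h - x) * (y + h) = y := by
    field_simp
    ring
  rw [e₁] at h₁
  rw [e₂] at h₂
  linear_combination h₁ + h₂ + (f x + f (y + h)) * hab

theorem stmt10 (α Δ : ℝ) (hα : 1 ≤ α) (hΔ : 1 ≤ Δ)
    (k : ℕ) (d : ℕ → ℝ)
    (hd : ∀ i < k, 1 ≤ d i ∧ d i ≤ Δ + i) :
    ∑ i ∈ Finset.range k, (1 + (d i + 1) ^ α - d i ^ α)
      ≤ k + (Δ + k) ^ α - Δ ^ α := by
  induction k with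
  | zero => simp
  | succ k ih =>
    obtain ⟨h₁, h₂⟩ := hd k k.lt_succ_self
    have hstep := (convexOn_rpow hα).sub_le_sub_of_le (Set.mem_Ici.2 (by linarith))
      (Set.mem_Ici.2 (by linarith)) h₂ one_pos
    have hsum := ih fun i hi => hd i (hi.trans k.lt_succ_self)
    rw [Finset.sum_range_succ]
    push_cast
    rw [← add_assoc Δ]
    linarith
end

section
/- Let α > 1 be real, let Δ ≥ 1 be real, let d be real with 1 ≤ d ≤ Δ, and let W ≥ Δ^α be real. Set W' := W + 1 + (d+1)^α − d^α. Then (W' − W)/W' ≤ (1 + α·2^{α−1})/Δ. -/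
/-- Tangent-line bound for the convex function `t ↦ t ^ p`. -/
theorem Real.rpow_sub_rpow_le_mul_sub {p x y : ℝ} (hp : 1 ≤ p) (hx : 0 ≤ x) (hy : 0 < y) :
    y ^ p - x ^ p ≤ p * y ^ (p - 1) * (y - x) := by
  have hs : 1 + (x / y - 1) = x / y := by ring
  have hxy : 0 ≤ x / y := by positivity
  have bernoulli := one_add_mul_self_le_rpow_one_add (s := x / y - 1) (by linarith) hp
  rw [hs, Real.div_rpow hx hy.le, le_div_iff₀ (by positivity)] at bernoulli
  have hyp : y ^ p = y ^ (p - 1) * y := by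
    rw [← Real.rpow_add_one hy.ne', sub_add_cancel]
  have expand : (1 + p * (x / y - 1)) * y ^ p = y ^ p - p * y ^ (p - 1) * (y - x) := by
    rw [hyp]
    field_simp
    ring
  linarith

theorem stmt12 (α Δ d W : ℝ) (hα : 1 < α) (hΔ : 1 ≤ Δ)
    (hd1 : 1 ≤ d) (hdΔ : d ≤ Δ) (hW : Δ ^ α ≤ W) :
    ((W + 1 + (d + 1) ^ α - d ^ α) - W) / (W + 1 + (d + 1) ^ α - d ^ α)
      ≤ (1 + α * 2 ^ (α - 1)) / Δ := by
  have hΔ0 : 0 < Δ := by linarith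
  have hmono : d ^ α ≤ (d + 1) ^ α :=
    Real.rpow_le_rpow (by linarith) (by linarith) (by linarith)
  have hdiff : (d + 1) ^ α - d ^ α ≤ α * (d + 1) ^ (α - 1) := by
    simpa using Real.rpow_sub_rpow_le_mul_sub (x := d) (y := d + 1) hα.le
      (by linarith) (by linarith)
  have hpow : (d + 1) ^ (α - 1) ≤ 2 ^ (α - 1) * Δ ^ (α - 1) := by
    rw [← Real.mul_rpow (by norm_num) hΔ0.le]
    exact Real.rpow_le_rpow (by linarith) (by linarith) (by linarith)
  have hone : 1 ≤ Δ ^ (α - 1) := Real.one_le_rpow hΔ (by linarith)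
  have hincr : 1 + (d + 1) ^ α - d ^ α ≤ (1 + α * 2 ^ (α - 1)) * Δ ^ (α - 1) := by
    have := mul_le_mul_of_nonneg_left hpow (by linarith : 0 ≤ α)
    linarith
  have hΔα : Δ ^ (α - 1) * Δ = Δ ^ α := by
    rw [← Real.rpow_add_one hΔ0.ne', sub_add_cancel]
  have hΔpos : 0 < Δ ^ α := by positivity
  rw [div_le_div_iff₀ (by linarith) hΔ0]
  calc (W + 1 + (d + 1) ^ α - d ^ α - W) * Δ
      = (1 + (d + 1) ^ α - d ^ α) * Δ := by ring
    _ ≤ (1 + α * 2 ^ (α - 1)) * Δ ^ (α - 1) * Δ := by gcongr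
    _ = (1 + α * 2 ^ (α - 1)) * Δ ^ α := by rw [mul_assoc, hΔα]
    _ ≤ (1 + α * 2 ^ (α - 1)) * (W + 1 + (d + 1) ^ α - d ^ α) := by
      gcongr
      linarith
end

section
/- Let k ≥ 2 be a natural number and consider the degree sequence consisting of one node of degree k−1 and k²−1 nodes of degree 1 (a graph on n₀ = k² nodes). For the simple edge-list rejection scheme with α = 2, the per-round acceptance probability equals (∑_v deg(v)²)/((∑_v deg(v))·Δ) = 2k/((k+2)(k−1)), and this is at most 3/k = 3/√n₀. -/
theorem Fin.sum_ite_val_eq_zero {n : ℕ} (hn : 0 < n) (a b : ℝ) :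
    ∑ i : Fin n, (if (i : ℕ) = 0 then a else b) = a + (n - 1) * b := by
  obtain ⟨m, rfl⟩ := Nat.exists_eq_add_of_lt hn
  rw [Fin.sum_univ_succ]
  simp

theorem stmt14 (k : ℕ) (hk : 2 ≤ k)
    (d : Fin (k ^ 2) → ℕ)
    (hd : ∀ i, d i = if (i : ℕ) = 0 then k - 1 else 1) :
    (∑ v, (d v : ℝ) ^ 2) / ((∑ v, (d v : ℝ)) * (Finset.univ.sup d : ℕ))
        = 2 * k / ((k + 2) * (k - 1 : ℝ))
      ∧ 2 * (k : ℝ) / ((k + 2) * (k - 1 : ℝ)) ≤ 3 / (k : ℝ)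
      ∧ (3 : ℝ) / (k : ℝ) = 3 / Real.sqrt ((k ^ 2 : ℕ) : ℝ) := by
  have hn : 0 < k ^ 2 := by positivity
  have hk' : (2 : ℝ) ≤ k := by exact_mod_cast hk
  have hcast : ((k - 1 : ℕ) : ℝ) = k - 1 := by
    rw [Nat.cast_sub (by omega), Nat.cast_one]
  have hpos : (0 : ℝ) < k - 1 := by linarith
  have hsum : ∑ v, (d v : ℝ) = (k + 2) * (k - 1) := by
    have h (v) : (d v : ℝ) = if (v : ℕ) = 0 then (k - 1 : ℝ) else 1 := by
      rw [hd]; split_ifs <;> simp [hcast]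
    simp_rw [h]
    rw [Fin.sum_ite_val_eq_zero hn]
    push_cast
    ring
  have hsq : ∑ v, (d v : ℝ) ^ 2 = 2 * k * (k - 1) := by
    have h (v) : (d v : ℝ) ^ 2 = if (v : ℕ) = 0 then (k - 1 : ℝ) ^ 2 else 1 := by
      rw [hd]; split_ifs <;> simp [hcast]
    simp_rw [h]
    rw [Fin.sum_ite_val_eq_zero hn]
    push_cast
    ring
  have hmax : Finset.univ.sup d = k - 1 := by
    apply le_antisymm
    · refine Finset.sup_le fun v _ => ?_
      rw [hd]
      split_ifs <;> omega
    · have h := Finset.le_sup (f := d) (Finset.mem_univ ⟨0, hn⟩)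
      simpa [hd ⟨0, hn⟩] using h
  refine ⟨?_, ?_, ?_⟩
  · rw [hsum, hsq, hmax, hcast]
    field_simp
  · rw [div_le_div_iff₀ (by positivity) (by positivity)]
    nlinarith
  · rw [Nat.cast_pow, Real.sqrt_sq (Nat.cast_nonneg k)]
end
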